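/- An infinite word u over a two-letter alphabet is Sturmian (i.e., its factor complexity satisfies C(n) = n + 1 for all n ∈ ℕ) if and only if every factor of u has exactly two return words. -/

import Mathlib

open List

/-- The factor of `u` of length `n` starting at position `i`. -/
def word {A : Type*} (u : ℕ → A) (i n : ℕ) : List A :=
  (List.range n).map (fun j => u (i + j))

/-- `w` occurs in `u` at position `i`. -/
def OccursAt {A : Type*} (u : ℕ → A) (w : List A) (i : ℕ) : Prop :=
  w = word u i w.length

/-- `w` is a factor of the infinite word `u`. -/
def IsFactor {A : Type*} (u : ℕ → A) (w : List A) : Prop :=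
  ∃ i, OccursAt u w i

/-- Every letter of the alphabet occurs in `u`. -/
def AllLettersOccur {A : Type*} (u : ℕ → A) : Prop :=
  ∀ a : A, ∃ i, u i = a

/-- The language of `u` is closed under reversal. -/
def ClosedUnderReversal {A : Type*} (u : ℕ → A) : Prop :=
  ∀ w : List A, IsFactor u w → IsFactor u w.reverse

/-- `u` is uniformly recurrent: every factor occurs in every window of some
bounded length. -/
def UniformlyRecurrent {A : Type*} (u : ℕ → A) : Prop :=
  ∀ w : List A, IsFactor u w → ∃ N : ℕ, ∀ i : ℕ, ∃ j : ℕ,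
    i ≤ j ∧ j < i + N ∧ OccursAt u w j

/-- Factor complexity: the number of factors of `u` of length `n`. -/
noncomputable def complexity {A : Type*} (u : ℕ → A) (n : ℕ) : ℕ :=
  Set.ncard {w : List A | w.length = n ∧ IsFactor u w}

/-- Palindromic complexity: the number of palindromic factors of `u` of
length `n`. -/
noncomputable def palComplexity {A : Type*} (u : ℕ → A) (n : ℕ) : ℕ :=
  Set.ncard {w : List A | w.length = n ∧ IsFactor u w ∧ w.reverse = w}

/-- The number of distinct palindromic factors of a finite word
(the empty word included). -/
noncomputable def palCount {A : Type*} (w : List A) : ℕ :=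
  Set.ncard {v : List A | v <:+: w ∧ v.reverse = v}

/-- `u` is rich in palindromes. -/
def Rich {A : Type*} (u : ℕ → A) : Prop :=
  ∀ w : List A, IsFactor u w → palCount w = w.length + 1

/-- `j < k` are two successive occurrences of `w` in `u`. -/
def SuccOccurrences {A : Type*} (u : ℕ → A) (w : List A) (j k : ℕ) : Prop :=
  OccursAt u w j ∧ OccursAt u w k ∧ j < k ∧
    ∀ l : ℕ, j < l → l < k → ¬ OccursAt u w l

/-- The set of return words of the factor `w` in `u`. -/
def returnWords {A : Type*} (u : ℕ → A) (w : List A) : Set (List A) :=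
  {v | ∃ j k : ℕ, SuccOccurrences u w j k ∧ v = word u j (k - j)}

/-- Left extensions of `w` in `u`. -/
def Lext {A : Type*} (u : ℕ → A) (w : List A) : Set A :=
  {a | IsFactor u (a :: w)}

/-- Right extensions of `w` in `u`. -/
def Rext {A : Type*} (u : ℕ → A) (w : List A) : Set A :=
  {b | IsFactor u (w ++ [b])}

/-- Bilateral extensions of `w` in `u`. -/
def Bext {A : Type*} (u : ℕ → A) (w : List A) : Set (A × A) :=
  {p | IsFactor u (p.1 :: (w ++ [p.2]))}

/-- Palindromic extensions of a (palindromic) factor `w` of `u`. -/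
def Pext {A : Type*} (u : ℕ → A) (w : List A) : Set (List A) :=
  {v | ∃ a : A, v = a :: (w ++ [a]) ∧ IsFactor u v}

/-- `w` is a bispecial factor of `u`. -/
def Bispecial {A : Type*} (u : ℕ → A) (w : List A) : Prop :=
  IsFactor u w ∧ 2 ≤ Set.ncard (Lext u w) ∧ 2 ≤ Set.ncard (Rext u w)

/-- The bilateral order of a factor `w` of `u`. -/
noncomputable def bilateralOrder {A : Type*} (u : ℕ → A) (w : List A) : ℤ :=
  (Set.ncard (Bext u w) : ℤ) - Set.ncard (Rext u w) - Set.ncard (Lext u w) + 1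

/-- `u` is eventually periodic. -/
def EventuallyPeriodic {A : Type*} (u : ℕ → A) : Prop :=
  ∃ p : ℕ, 0 < p ∧ ∃ N : ℕ, ∀ n : ℕ, N ≤ n → u (n + p) = u n

/-- `u` is aperiodic. -/
def Aperiodic {A : Type*} (u : ℕ → A) : Prop :=
  ¬ EventuallyPeriodic u

/-- `u` is (1-)balanced. -/
def IsBalanced {A : Type*} [DecidableEq A] (u : ℕ → A) : Prop :=
  ∀ a : A, ∀ w v : List A, IsFactor u w → IsFactor u v → w.length = v.length →
    |(w.count a : ℤ) - (v.count a : ℤ)| ≤ 1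


/-- The factors of length `n` at positions `i` and `j` agree. -/
def EqW {A : Type*} (u : ℕ → A) (n i j : ℕ) : Prop := ∀ k, k < n → u (i + k) = u (j + k)

/-- `p` is the gap to the next occurrence of the factor of length `n` at `i`. -/
def RetGap {A : Type*} (u : ℕ → A) (n i p : ℕ) : Prop :=
  0 < p ∧ EqW u n i (i + p) ∧ ∀ q, 0 < q → q < p → ¬ EqW u n i (i + q)

/-- The factor of length `n` at `i` is right special. -/
def RSp {A : Type*} (u : ℕ → A) (n i : ℕ) : Prop := ∃ j, EqW u n i j ∧ u (i + n) ≠ u (j + n)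

/-- recurrence in terms of positions -/
def Recur {A : Type*} (u : ℕ → A) : Prop := ∀ n i, ∃ j, i < j ∧ EqW u n i j

section helpers
variable {A : Type*} {u : ℕ → A}

theorem EqW.symm {n i j : ℕ} (h : EqW u n i j) : EqW u n j i := fun k hk => (h k hk).symm

theorem EqW.trans {n i j l : ℕ} (h : EqW u n i j) (h' : EqW u n j l) : EqW u n i l :=
  fun k hk => (h k hk).trans (h' k hk)

theorem EqW.rfl' {n i : ℕ} : EqW u n i i := fun _ _ => rfl

theorem EqW.mono {n m i j : ℕ} (h : EqW u n i j) (hm : m ≤ n) : EqW u m i j :=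
  fun k hk => h k (by omega)

theorem EqW.sub {n i j : ℕ} (h : EqW u n i j) (m i' j' k : ℕ) (hi : i' = i + k) (hj : j' = j + k)
    (hk : k + m ≤ n) : EqW u m i' j' := by
  intro l hl
  have := h (k + l) (by omega)
  subst hi hj
  rw [Nat.add_assoc, Nat.add_assoc]; exact this

theorem EqW.at {n i j : ℕ} (h : EqW u n i j) (x y k : ℕ) (hi : x = i + k) (hj : y = j + k)
    (hk : k < n) : u x = u y := by subst hi hj; exact h k hk

theorem EqW.glue {n m p i j : ℕ} (h : EqW u p i j) (h' : EqW u n (i + p) (j + p))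
    (hm : m ≤ p + n) : EqW u m i j := by
  intro k hk
  by_cases hkp : k < p
  · exact h k hkp
  · exact h'.at _ _ (k - p) (by omega) (by omega) (by omega)

theorem EqW.succ {n i j : ℕ} (h : EqW u n i j) (h' : u (i + n) = u (j + n)) :
    EqW u (n + 1) i j := by
  intro k hk
  rcases Nat.lt_succ_iff_lt_or_eq.mp hk with h1 | h1
  · exact h k h1
  · rw [h1]; exact h'

theorem EqW.cons {n i j : ℕ} (h : EqW u n (i + 1) (j + 1)) (h' : u i = u j) :
    EqW u (n + 1) i j := by
  intro k hk
  cases k with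
  | zero => exact h'
  | succ k => exact h.at _ _ k (by omega) (by omega) (by omega)

theorem word_length' (i n : ℕ) : (word u i n).length = n := by simp [word]

theorem word_eq_iff (i j n : ℕ) : word u i n = word u j n ↔ EqW u n i j := by
  simp [word, EqW]

theorem word_succ (i n : ℕ) : word u i (n + 1) = word u i n ++ [u (i + n)] := by
  simp [word, List.range_succ]

theorem occursAt_word (i n j : ℕ) : OccursAt u (word u i n) j ↔ EqW u n i j := by
  unfold OccursAt; rw [word_length', word_eq_iff]

theorem isFactor_word (i n : ℕ) : IsFactor u (word u i n) :=
  ⟨i, (occursAt_word _ _ _).2 EqW.rfl'⟩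

theorem returnWords_word (i n : ℕ) : returnWords u (word u i n) =
    {v | ∃ j p, EqW u n i j ∧ RetGap u n j p ∧ v = word u j p} := by
  ext v
  simp only [returnWords, SuccOccurrences, occursAt_word, Set.mem_setOf_eq]
  constructor
  · rintro ⟨j, k, ⟨h1, h2, h3, h4⟩, rfl⟩
    refine ⟨j, k - j, h1, ⟨by omega, ?_, ?_⟩, rfl⟩
    · rw [show j + (k - j) = k by omega]; exact h1.symm.trans h2
    · intro q hq hq' h
      exact h4 (j + q) (by omega) (by omega) (h1.trans h)
  · rintro ⟨j, p, h1, ⟨h2, h3, h4⟩, rfl⟩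
    refine ⟨j, j + p, ⟨h1, h1.trans h3, by omega, ?_⟩, by simp⟩
    intro l hl hl' h
    refine h4 (l - j) (by omega) (by omega) ?_
    rw [show j + (l - j) = l by omega]; exact h1.symm.trans h

theorem RetGap.exists (hr : Recur u) (n i : ℕ) : ∃ p, RetGap u n i p := by
  classical
  have h : ∃ p, 0 < p ∧ EqW u n i (i + p) := by
    obtain ⟨j, hj, h⟩ := hr n i
    exact ⟨j - i, by omega, by rw [show i + (j - i) = j by omega]; exact h⟩
  refine ⟨Nat.find h, (Nat.find_spec h).1, (Nat.find_spec h).2, ?_⟩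
  intro q hq hq' h'
  exact Nat.find_min h hq' ⟨hq, h'⟩

theorem RetGap.unique {n i p q : ℕ} (h : RetGap u n i p) (h' : RetGap u n i q) : p = q := by
  rcases lt_trichotomy p q with hl | hl | hl
  · exact absurd h.2.1 (h'.2.2 p h.1 hl)
  · exact hl
  · exact absurd h'.2.1 (h.2.2 q h'.1 hl)

/-- agreeing long enough transfers return gaps -/
theorem RetGap.transfer {n i j p m : ℕ} (h : RetGap u n i p) (hp : p ≤ m)
    (he : EqW u (m + n) i j) : RetGap u n j p := by
  have hn : EqW u n i j := he.mono (by omega)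
  have key : ∀ q, q ≤ p → EqW u n (i + q) (j + q) := fun q hq =>
    he.sub n _ _ q rfl rfl (by omega)
  refine ⟨h.1, ?_, ?_⟩
  · exact (hn.symm.trans h.2.1).trans (key p le_rfl)
  · intro q hq hq' h'
    exact h.2.2 q hq hq' ((hn.trans h').trans (key q hq'.le).symm)

/-- The last occurrence of a class before a given occurrence. -/
theorem lastOcc {n b k t : ℕ} (hk : EqW u n b k) (ht : EqW u n b t) (hkt : k < t) :
    ∃ q, k ≤ q ∧ q < t ∧ EqW u n b q ∧ RetGap u n q (t - q) := by
  classical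
  have h : ∃ s, 0 < s ∧ s ≤ t - k ∧ EqW u n b (t - s) :=
    ⟨t - k, by omega, le_rfl, by rw [show t - (t - k) = k by omega]; exact hk⟩
  obtain ⟨h1, h2, h3⟩ := Nat.find_spec h
  have hmin := fun {m : ℕ} => Nat.find_min h (m := m)
  generalize Nat.find h = s at *
  refine ⟨t - s, by omega, by omega, h3, by omega, ?_, ?_⟩
  · rw [show t - s + (t - (t - s)) = t by omega]; exact h3.symm.trans ht
  · intro q hq hq' h'
    refine hmin (m := s - q) (by omega) ⟨by omega, by omega, ?_⟩
    rw [show t - (s - q) = t - s + q by omega]; exact h3.trans h'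

theorem RSp.transfer {n i j : ℕ} (h : RSp u n i) (he : EqW u n i j) : RSp u n j := by
  obtain ⟨l, hl, hne⟩ := h
  by_cases h' : u (j + n) = u (l + n)
  · exact ⟨i, he.symm, fun h'' => hne (h''.symm.trans h')⟩
  · exact ⟨l, he.symm.trans hl, h'⟩

theorem RSp.tail {n i : ℕ} (h : RSp u (n + 1) i) : RSp u n (i + 1) := by
  obtain ⟨l, hl, hne⟩ := h
  refine ⟨l + 1, hl.sub n _ _ 1 rfl rfl (by omega), ?_⟩
  rw [show i + 1 + n = i + (n + 1) by omega, show l + 1 + n = l + (n + 1) by omega]; exact hne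

/-! ### Counting -/

/-- right special factors of length `n` -/
def RSset (u : ℕ → A) (n : ℕ) : Set (List A) := {w | ∃ i, RSp u n i ∧ w = word u i n}

theorem facset_eq (n : ℕ) : {w : List A | w.length = n ∧ IsFactor u w} =
    Set.range (fun i => word u i n) := by
  ext w
  constructor
  · rintro ⟨rfl, i, h⟩; exact ⟨i, h.symm⟩
  · rintro ⟨i, rfl⟩; exact ⟨word_length' _ _, isFactor_word _ _⟩

theorem complexity_eq (n : ℕ) : complexity u n = (Set.range (fun i => word u i n)).ncard := by
  unfold complexity; rw [facset_eq]

theorem facset_fin [Finite A] (n : ℕ) : (Set.range (fun i => word u i n)).Finite :=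
  (List.finite_length_eq A n).subset (by rintro _ ⟨i, rfl⟩; exact word_length' _ _)

theorem complexity_zero : complexity u 0 = 1 := by
  rw [complexity_eq]; simp [word]

theorem complexity_succ [Finite A] {a b : A} (hab : a ≠ b) (hA : ∀ x : A, x = a ∨ x = b) (n : ℕ) :
    complexity u (n + 1) = complexity u n + (RSset u n).ncard := by
  have hfin := facset_fin (u := u) n
  set F : A → Set (List A) := fun x => {w | ∃ i, u (i + n) = x ∧ w = word u i n} with hF
  have hFs : ∀ x, F x ⊆ Set.range (fun i => word u i n) := by
    rintro x _ ⟨i, _, rfl⟩; exact ⟨i, rfl⟩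
  have h1 : Set.range (fun i => word u i (n + 1)) =
      (fun w => w ++ [a]) '' F a ∪ (fun w => w ++ [b]) '' F b := by
    ext w
    constructor
    · rintro ⟨i, rfl⟩
      simp only [word_succ]
      rcases hA (u (i + n)) with h | h
      · left; exact ⟨_, ⟨i, h, rfl⟩, by simp [h]⟩
      · right; exact ⟨_, ⟨i, h, rfl⟩, by simp [h]⟩
    · rintro (⟨_, ⟨i, h, rfl⟩, rfl⟩ | ⟨_, ⟨i, h, rfl⟩, rfl⟩) <;>
        exact ⟨i, by simp [word_succ, h]⟩
  have h2 : F a ∪ F b = Set.range (fun i => word u i n) := by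
    apply Set.Subset.antisymm (Set.union_subset (hFs a) (hFs b))
    rintro _ ⟨i, rfl⟩
    rcases hA (u (i + n)) with h | h
    · left; exact ⟨i, h, rfl⟩
    · right; exact ⟨i, h, rfl⟩
  have h3 : F a ∩ F b = RSset u n := by
    ext w
    constructor
    · rintro ⟨⟨i, h, rfl⟩, ⟨j, h', he⟩⟩
      exact ⟨i, ⟨j, (word_eq_iff _ _ _).1 he, by rw [h, h']; exact hab⟩, rfl⟩
    · rintro ⟨i, ⟨j, he, hne⟩, rfl⟩
      have he' := (word_eq_iff i j n).2 he
      rcases hA (u (i + n)) with h | h <;> rcases hA (u (j + n)) with h' | h'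
      · exact absurd (h.trans h'.symm) hne
      · exact ⟨⟨i, h, rfl⟩, ⟨j, h', he'⟩⟩
      · exact ⟨⟨j, h', he'⟩, ⟨i, h, rfl⟩⟩
      · exact absurd (h.trans h'.symm) hne
  rw [complexity_eq, complexity_eq, h1, ← h2, ← h3,
    Set.ncard_union_eq ?_ ((hfin.subset (hFs a)).image _) ((hfin.subset (hFs b)).image _),
    Set.ncard_image_of_injective _ (fun x y h => by simpa using h),
    Set.ncard_image_of_injective _ (fun x y h => by simpa using h),
    Set.ncard_union_add_ncard_inter _ _ (hfin.subset (hFs a)) (hfin.subset (hFs b))]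
  · rw [Set.disjoint_left]
    rintro _ ⟨v, _, rfl⟩ ⟨v', _, h⟩
    have := List.append_inj_right' h rfl
    simp at this
    exact hab this.symm

theorem RSset_ncard_one {n : ℕ} (hex : ∃ i, RSp u n i)
    (hun : ∀ i j, RSp u n i → RSp u n j → EqW u n i j) : (RSset u n).ncard = 1 := by
  obtain ⟨i, hi⟩ := hex
  rw [Set.ncard_eq_one]
  refine ⟨word u i n, ?_⟩
  ext w
  constructor
  · rintro ⟨j, hj, rfl⟩; exact (word_eq_iff _ _ _).2 (hun _ _ hj hi)
  · rintro rfl; exact ⟨i, hi, rfl⟩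

theorem complexity_of_one [Finite A] {a b : A} (hab : a ≠ b) (hA : ∀ x : A, x = a ∨ x = b)
    (h : ∀ n, (RSset u n).ncard = 1) (n : ℕ) : complexity u n = n + 1 := by
  induction n with
  | zero => exact complexity_zero
  | succ n ih => rw [complexity_succ hab hA, ih, h]

/-! ### Two return words imply Sturmian -/

/-- all factors have two return words -/
def TwoRet (u : ℕ → A) : Prop := ∀ w : List A, IsFactor u w → Set.ncard (returnWords u w) = 2

theorem TwoRet.recur (h : TwoRet u) : Recur u := by
  intro n i
  have h2 := h _ (isFactor_word 0 (i + n))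
  have hne : (returnWords u (word u 0 (i + n))).Nonempty := by
    apply Set.nonempty_of_ncard_ne_zero; omega
  rw [returnWords_word] at hne
  obtain ⟨_, j, p, hj, ⟨hp, hjp, _⟩, _⟩ := hne
  exact ⟨j + p + i, by omega, (hj.trans hjp).sub n _ _ i (by omega) rfl (by omega)⟩

theorem TwoRet.det (h : TwoRet u) {n i j p : ℕ} (hrs : RSp u n i) (he : EqW u (n + 1) i j)
    (hp : RetGap u n i p) : EqW u (p + n) i j := by
  obtain ⟨i', hi', hne⟩ := hrs
  obtain ⟨p', hp'⟩ := RetGap.exists h.recur n i'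
  obtain ⟨q, hq⟩ := RetGap.exists h.recur n j
  have hen : EqW u n i j := he.mono (by omega)
  -- equal return words of the class give long agreement
  have key : ∀ x y s t, EqW u n i x → EqW u n i y → RetGap u n x s → RetGap u n y t →
      word u x s = word u y t → s = t ∧ EqW u (s + n) x y := by
    intro x y s t hx hy hs ht hw
    have hst : s = t := by simpa [word_length'] using congrArg List.length hw
    subst hst
    refine ⟨rfl, ((word_eq_iff _ _ _).1 hw).glue ?_ le_rfl⟩
    exact ((hx.trans hs.2.1).symm).trans (hy.trans ht.2.1)
  have h2 := h _ (isFactor_word i n)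
  rw [returnWords_word, Set.ncard_eq_two] at h2
  obtain ⟨x, y, hxy, hset⟩ := h2
  have m1 : word u i p ∈ ({x, y} : Set (List A)) := hset ▸ ⟨i, p, EqW.rfl', hp, rfl⟩
  have m2 : word u i' p' ∈ ({x, y} : Set (List A)) := hset ▸ ⟨i', p', hi', hp', rfl⟩
  have m3 : word u j q ∈ ({x, y} : Set (List A)) := hset ▸ ⟨j, q, hen, hq, rfl⟩
  have n1 : word u i p ≠ word u i' p' := fun hw =>
    hne ((key _ _ _ _ EqW.rfl' hi' hp hp' hw).2 n (by have := hp.1; omega))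
  have n2 : word u j q ≠ word u i' p' := fun hw =>
    hne ((he n (by omega)).trans
      ((key _ _ _ _ hen hi' hq hp' hw).2 n (by have := hq.1; omega)))
  have : word u i p = word u j q := by
    simp only [Set.mem_insert_iff, Set.mem_singleton_iff] at m1 m2 m3
    grind
  exact (key _ _ _ _ EqW.rfl' hen hp hq this).2

theorem TwoRet.not_unique (h : TwoRet u) {n b : ℕ}
    (hd : ∀ i j, EqW u n b i → EqW u n b j → ∃ m, 0 < m ∧ EqW u n i (i + m) ∧ EqW u (m + n) i j) :
    False := by
  have h2 := h _ (isFactor_word b n)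
  rw [returnWords_word, Set.ncard_eq_two] at h2
  obtain ⟨x, y, hxy, hset⟩ := h2
  have m1 : x ∈ ({x, y} : Set (List A)) := by simp
  have m2 : y ∈ ({x, y} : Set (List A)) := by simp
  rw [← hset] at m1 m2
  obtain ⟨i, p, hi, hp, rfl⟩ := m1
  obtain ⟨j, q, hj, hq, rfl⟩ := m2
  obtain ⟨m, hm, h1, h2⟩ := hd i j hi hj
  have hpm : p ≤ m := by
    by_contra hc
    exact hp.2.2 m hm (by omega) h1
  have := (hp.transfer hpm h2).unique hq
  subst this
  exact hxy ((word_eq_iff _ _ _).2 (h2.mono (by omega)))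

theorem TwoRet.exists_rs (h : TwoRet u) (n : ℕ) : ∃ i, RSp u n i := by
  by_contra hc
  apply h.not_unique (n := n) (b := 0)
  intro i j hi hj
  obtain ⟨p, hp⟩ := RetGap.exists h.recur n i
  refine ⟨p, hp.1, hp.2.1, ?_⟩
  have : ∀ m, EqW u (m + n) i j := by
    intro m
    induction m with
    | zero => simpa using hi.symm.trans hj
    | succ m ih =>
      rw [show m + 1 + n = (m + n) + 1 by omega]
      apply ih.succ
      by_contra hne
      apply hc
      exact ⟨i + m, j + m, ih.sub n _ _ m rfl rfl le_rfl, by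
        rwa [Nat.add_assoc, Nat.add_assoc]⟩
  exact this p

theorem TwoRet.step [Finite A] (h : TwoRet u) {a b : A} (hA : ∀ x : A, x = a ∨ x = b) {n i j : ℕ}
    (hi : RSp u (n + 1) i) (hj : RSp u (n + 1) j) (hw : EqW u n (i + 1) (j + 1)) :
    u i = u j := by
  by_contra hab
  have hA3 : ∀ x y z : A, x ≠ y → z ≠ y → x = z := by
    intro x y z h1 h2
    rcases hA x with e | e <;> rcases hA y with e' | e' <;> rcases hA z with e'' | e'' <;> grind
  have hcls : ∀ k, EqW u n (i + 1) (k + 1) → RSp u (n + 1) k := by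
    intro k hk
    by_cases hc : u i = u k
    · exact hi.transfer (hk.cons hc)
    · exact hj.transfer ((hw.symm.trans hk).cons
        (hA3 _ (u i) _ (Ne.symm hab) (fun h => hc h.symm)))
  have hrs : ∀ k, EqW u n (i + 1) k → RSp u n k := fun k hk => hi.tail.transfer hk
  -- the letter before the next occurrence
  have hf : ∀ x : A, ∃ y : A, ∀ m s, EqW u n (i + 1) m → RetGap u n m s → u (m + n) = x →
      u (m + s - 1) = y := by
    intro x
    by_cases hc : ∃ m, EqW u n (i + 1) m ∧ u (m + n) = x
    · obtain ⟨m0, hm0, hx⟩ := hc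
      obtain ⟨s0, hs0⟩ := RetGap.exists h.recur n m0
      refine ⟨u (m0 + s0 - 1), ?_⟩
      intro m s hm hs hmx
      have he := h.det (hrs _ hm0) ((hm0.symm.trans hm).succ (hx.trans hmx.symm)) hs0
      have := (hs0.transfer le_rfl he).unique hs
      subst this
      have := hs0.1
      exact (he.at _ _ (s0 - 1) (by omega) (by omega) (by omega)).symm
    · exact ⟨x, fun m s hm _ hx => absurd ⟨m, hm, hx⟩ hc⟩
  choose f hf using hf
  have hsurj : Function.Surjective f := by
    intro y
    have : ∃ k, EqW u n (i + 1) (k + 1) ∧ u k = y := by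
      by_cases hc : u i = y
      · exact ⟨i, EqW.rfl', hc⟩
      · exact ⟨j, hw, hA3 _ (u i) _ (Ne.symm hab) (fun h => hc h.symm)⟩
    obtain ⟨k, hk, hky⟩ := this
    obtain ⟨k', hlt, hkk⟩ := h.recur (n + 1) k
    have hk' : EqW u n (i + 1) (k' + 1) := hk.trans (hkk.sub n _ _ 1 rfl rfl (by omega))
    obtain ⟨q, hq1, hq2, hq3, hq4⟩ := lastOcc hk hk' (by omega)
    refine ⟨u (q + n), ?_⟩
    rw [← hf _ q _ hq3 hq4 rfl, ← hky]
    exact (hkk.at _ _ 0 rfl (by omega) (by omega)).symm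
  have hinj : Function.Injective f := Finite.injective_iff_surjective.mpr hsurj
  -- half step
  have half : ∀ k k', EqW u n (i + 1) (k + 1) → f (u (k + 1 + n)) ≠ u k → EqW u (n + 2) k k' →
      ∃ q, k < q ∧ EqW u n (i + 1) (q + 1) ∧ f (u (q + 1 + n)) ≠ u q ∧ u q ≠ u k ∧
        EqW u (q - k + n + 2) k k' := by
    intro k k' hk hQ he
    obtain ⟨p, hp⟩ := RetGap.exists h.recur (n + 1) k
    have hpp := hp.1
    have hlong := h.det (hcls k hk) he hp
    have ht : EqW u n (i + 1) (k + p + 1) := hk.trans (hp.2.1.sub n _ _ 1 rfl rfl (by omega))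
    obtain ⟨q1, hq1, hq2, hq3, hq4⟩ := lastOcc hk ht (by omega)
    obtain ⟨q, rfl⟩ : ∃ q, q1 = q + 1 := ⟨q1 - 1, by omega⟩
    have hlet : f (u (q + 1 + n)) = u k := by
      rw [← hf _ (q + 1) _ hq3 hq4 rfl]
      exact (hp.2.1.at _ _ 0 rfl (by omega) (by omega)).symm
    have hqk : q ≠ k := by
      rintro rfl; exact hQ hlet
    have hne : u q ≠ u k := by
      intro hc
      refine hp.2.2 (q - k) (by omega) (by omega) ?_
      rw [show k + (q - k) = q by omega]
      exact (hk.symm.trans hq3).cons hc.symm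
    exact ⟨q, by omega, hq3, by rw [hlet]; exact hne.symm, hne, hlong.mono (by omega)⟩
  -- a starting point
  obtain ⟨k0, hk0, hQ0⟩ : ∃ k, EqW u n (i + 1) (k + 1) ∧ f (u (k + 1 + n)) ≠ u k := by
    obtain ⟨l, hl, hne⟩ := hi
    have e1 : i + (n + 1) = i + 1 + n := by omega
    have e2 : l + (n + 1) = l + 1 + n := by omega
    rw [e1, e2] at hne
    by_cases hc : f (u (i + 1 + n)) = u i
    · refine ⟨l, hl.sub n _ _ 1 rfl rfl (by omega), ?_⟩
      rw [← hl.at i l 0 rfl rfl (by omega), ← hc]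
      exact fun h' => hne (hinj h'.symm)
    · exact ⟨i, EqW.rfl', hc⟩
  have hQt : ∀ k k', EqW u (n + 2) k k' → EqW u n (i + 1) (k + 1) → f (u (k + 1 + n)) ≠ u k →
      EqW u n (i + 1) (k' + 1) ∧ f (u (k' + 1 + n)) ≠ u k' := by
    intro k k' he hk hQ
    refine ⟨hk.trans (he.sub n _ _ 1 rfl rfl (by omega)), ?_⟩
    rw [← he.at k k' 0 rfl rfl (by omega),
      ← he.at (k + 1 + n) (k' + 1 + n) (n + 1) (by omega) (by omega) (by omega)]
    exact hQ
  apply h.not_unique (n := n + 2) (b := k0)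
  intro x y hx hy
  obtain ⟨hkx, hQx⟩ := hQt _ _ hx hk0 hQ0
  obtain ⟨q, hq1, hq2, hq3, hq4, hq5⟩ := half x y hkx hQx (hx.symm.trans hy)
  have hq6 : EqW u (n + 2) q (y + (q - x)) := hq5.sub _ _ _ (q - x) (by omega) rfl (by omega)
  obtain ⟨r, hr1, hr2, hr3, hr4, hr5⟩ := half q _ hq2 hq3 hq6
  have hux : u r = u x := hA3 _ (u q) _ hr4 hq4.symm
  refine ⟨r - x, by omega, ?_, ?_⟩
  · rw [show x + (r - x) = r by omega]
    have h1 : EqW u (n + 1) x r := (hkx.symm.trans hr2).cons hux.symm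
    apply h1.succ
    rw [show x + (n + 1) = x + 1 + n by omega, show r + (n + 1) = r + 1 + n by omega]
    apply hinj
    refine hA3 _ (u x) _ hQx (hux ▸ hr3)
  · refine (hq5.mono (m := q - x) (by omega)).glue (n := r - q + n + 2) ?_ (by omega)
    rw [show x + (q - x) = q by omega]; exact hr5

theorem TwoRet.unique_rs [Finite A] (h : TwoRet u) {a b : A} (hA : ∀ x : A, x = a ∨ x = b) (n : ℕ) :
    ∀ i j, RSp u n i → RSp u n j → EqW u n i j := by
  induction n with
  | zero => intro i j _ _ k hk; omega
  | succ n ih =>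
    intro i j hi hj
    have hw := ih _ _ hi.tail hj.tail
    exact hw.cons (h.step hA hi hj hw)

/-! ### Sturmian implies two return words -/

theorem not_evper (hC : ∀ n, complexity u n = n + 1) {p N : ℕ} (hp : 0 < p)
    (h : ∀ m, N ≤ m → u (m + p) = u m) : False := by
  have h1 := hC (N + p)
  rw [complexity_eq] at h1
  have hsub : Set.range (fun i => word u i (N + p)) ⊆
      (fun i => word u i (N + p)) '' (Finset.range (N + p) : Set ℕ) := by
    rintro _ ⟨i, rfl⟩
    induction i using Nat.strong_induction_on with
    | _ i ih =>
      by_cases hi : i < N + p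
      · exact ⟨i, by simpa using hi, rfl⟩
      · have : word u i (N + p) = word u (i - p) (N + p) := by
          rw [word_eq_iff]
          intro k _
          rw [← h (i - p + k) (by omega)]
          congr 1; omega
        simp only [this]
        exact ih (i - p) (by omega)
  have h2 := Set.ncard_le_ncard hsub ((Finset.finite_toSet _).image _)
  have h3 := Set.ncard_image_le (f := fun i => word u i (N + p))
    (Finset.finite_toSet (Finset.range (N + p)))
  rw [Set.ncard_coe_finset, Finset.card_range] at h3
  omega

/-- distinct positions eventually differ -/
theorem differ (hC : ∀ n, complexity u n = n + 1) {i j : ℕ} (hij : i < j) : ∃ m, ¬ EqW u m i j := by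
  by_contra hc
  push Not at hc
  refine not_evper hC (p := j - i) (N := i) (by omega) ?_
  intro m hm
  exact ((hc (m - i + 1)).at _ _ (m - i) (by omega) (by omega) (by omega)).symm

theorem sturm_unique [Finite A] {a b : A} (hab : a ≠ b) (hA : ∀ x : A, x = a ∨ x = b)
    (hC : ∀ n, complexity u n = n + 1) (n : ℕ) :
    ∀ i j, RSp u n i → RSp u n j → EqW u n i j := by
  have h1 := complexity_succ (u := u) hab hA n
  rw [hC, hC] at h1
  have h2 : (RSset u n).ncard = 1 := by omega
  obtain ⟨w, hw⟩ := Set.ncard_eq_one.1 h2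
  intro i j hi hj
  have m1 : word u i n ∈ RSset u n := ⟨i, hi, rfl⟩
  have m2 : word u j n ∈ RSset u n := ⟨j, hj, rfl⟩
  rw [hw] at m1 m2
  exact (word_eq_iff _ _ _).1 (m1.trans m2.symm)

theorem eqW_shift (N n i j : ℕ) :
    EqW (fun k => u (N + k)) n i j ↔ EqW u n (N + i) (N + j) := by
  simp [EqW, Nat.add_assoc]

theorem sturm_recur [Finite A] {a b : A} (hab : a ≠ b) (hA : ∀ x : A, x = a ∨ x = b)
    (hC : ∀ n, complexity u n = n + 1) : Recur u := by
  intro n i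
  set N := i + 1 with hN
  set v : ℕ → A := fun k => u (N + k) with hv
  have hrs : ∀ m k, RSp v m k → RSp u m (N + k) := by
    rintro m k ⟨l, hl, hne⟩
    exact ⟨N + l, (eqW_shift _ _ _ _).1 hl, by simpa [hv, Nat.add_assoc] using hne⟩
  have hone : ∀ m, (RSset v m).ncard = 1 := by
    intro m
    apply RSset_ncard_one
    · -- pigeonhole
      have : ∃ x y, x < y ∧ EqW u m (N + x) (N + y) := by
        have hfin := facset_fin (u := v) m
        haveI := hfin.to_subtype
        obtain ⟨x, y, hxy, he⟩ := Finite.exists_ne_map_eq_of_infinite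
          (fun k : ℕ => (⟨word v k m, ⟨k, rfl⟩⟩ : Set.range (fun i => word v i m)))
        have he' : word v x m = word v y m := congrArg Subtype.val he
        have he'' := (eqW_shift _ _ _ _).1 ((word_eq_iff _ _ _).1 he')
        rcases lt_or_gt_of_ne hxy with hl | hl
        · exact ⟨x, y, hl, he''⟩
        · exact ⟨y, x, hl, he''.symm⟩
      obtain ⟨x, y, hxy, he⟩ := this
      obtain ⟨M, hM⟩ := differ hC (show N + x < N + y by omega)
      by_contra hc
      apply hM
      have : ∀ t, EqW u (t + m) (N + x) (N + y) := by
        intro t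
        induction t with
        | zero => simpa using he
        | succ t ih =>
          rw [show t + 1 + m = (t + m) + 1 by omega]
          apply ih.succ
          by_contra hne
          apply hc
          refine ⟨x + t, y + t, (eqW_shift _ _ _ _).2
            (ih.sub m _ _ t (by omega) (by omega) le_rfl), ?_⟩
          simpa [hv, Nat.add_assoc] using hne
      exact (this M).mono (by omega)
    · intro x y hx hy
      exact (eqW_shift _ _ _ _).2 (sturm_unique hab hA hC m _ _ (hrs _ _ hx) (hrs _ _ hy))
  have hCv := complexity_of_one hab hA hone n
  have hCu := hC n
  rw [complexity_eq] at hCv hCu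
  have hws : ∀ k m, word v k m = word u (N + k) m := by
    intro k m; simp [word, hv, Nat.add_assoc]
  have hsub : Set.range (fun i => word v i n) ⊆ Set.range (fun i => word u i n) := by
    rintro _ ⟨k, rfl⟩
    exact ⟨N + k, (hws _ _).symm⟩
  have heq := Set.eq_of_subset_of_ncard_le hsub (by omega) (facset_fin n)
  have : word u i n ∈ Set.range (fun i => word v i n) := by rw [heq]; exact ⟨i, rfl⟩
  obtain ⟨k, hk⟩ := this
  simp only [hws] at hk
  exact ⟨N + k, by omega, ((word_eq_iff _ _ _).1 hk).symm⟩

theorem sturm_rs [Finite A] {a b : A} (hab : a ≠ b) (hA : ∀ x : A, x = a ∨ x = b)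
    (hC : ∀ n, complexity u n = n + 1) {n i : ℕ} (hrs : RSp u n i) :
    (returnWords u (word u i n)).ncard = 2 := by
  have hr := sturm_recur hab hA hC
  obtain ⟨i', hi', hne⟩ := hrs
  have hrs' : RSp u n i' := RSp.transfer ⟨i', hi', hne⟩ hi'
  obtain ⟨p, hp⟩ := RetGap.exists hr n i
  obtain ⟨p', hp'⟩ := RetGap.exists hr n i'
  have det : ∀ x y s, RSp u n x → EqW u (n + 1) x y → RetGap u n x s → EqW u (s + n) x y := by
    intro x y s hx he hs
    have : ∀ t, t + 1 ≤ s → EqW u (t + 1 + n) x y := by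
      intro t
      induction t with
      | zero => intro _; exact he.mono (by omega)
      | succ t ih =>
        intro hts
        have ih' := ih (by omega)
        rw [show t + 1 + 1 + n = (t + 1 + n) + 1 by omega]
        apply ih'.succ
        by_contra hne
        refine hs.2.2 (t + 1) (by omega) (by omega) (sturm_unique hab hA hC n _ _ hx ?_)
        exact ⟨y + (t + 1), ih'.sub n _ _ (t + 1) rfl rfl le_rfl, by
          rwa [Nat.add_assoc, Nat.add_assoc y]⟩
    have hs1 := hs.1
    have h2 := this (s - 1) (by omega)
    rwa [show s - 1 + 1 = s by omega] at h2
  rw [returnWords_word, Set.ncard_eq_two]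
  refine ⟨word u i p, word u i' p', ?_, ?_⟩
  · intro hw
    have hst : p = p' := by simpa [word_length'] using congrArg List.length hw
    subst hst
    have : EqW u (p + n) i i' := ((word_eq_iff _ _ _).1 hw).glue
      (hp.2.1.symm.trans (hi'.trans hp'.2.1)) le_rfl
    exact hne (this n (by have := hp.1; omega))
  · have aux : ∀ x y s t, RSp u n x → EqW u (n + 1) x y → RetGap u n x s → RetGap u n y t →
        word u y t = word u x s := by
      intro x y s t hx he hs ht
      have hl := det x y s hx he hs
      have := (hs.transfer le_rfl hl).unique ht
      subst this
      exact ((word_eq_iff _ _ _).2 (hl.mono (by omega))).symm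
    ext v
    constructor
    · rintro ⟨j, q, hj, hq, rfl⟩
      by_cases hc : u (i + n) = u (j + n)
      · left; exact aux i j p q ⟨i', hi', hne⟩ (hj.succ hc) hp hq
      · right
        refine aux i' j p' q hrs' ((hi'.symm.trans hj).succ ?_) hp' hq
        rcases hA (u (i + n)) with e | e <;> rcases hA (u (i' + n)) with e' | e' <;>
          rcases hA (u (j + n)) with e'' | e'' <;> grind
    · rintro (rfl | rfl)
      · exact ⟨i, p, EqW.rfl', hp, rfl⟩
      · exact ⟨i', p', hi', hp', rfl⟩

theorem sturm_two [Finite A] {a b : A} (hab : a ≠ b) (hA : ∀ x : A, x = a ∨ x = b)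
    (hC : ∀ n, complexity u n = n + 1) : TwoRet u := by
  classical
  rintro w ⟨i, hw⟩
  have hr := sturm_recur hab hA hC
  obtain ⟨n, rfl⟩ : ∃ n, w = word u i n := ⟨_, hw⟩
  have h : ∃ L j, EqW u n i j ∧ ¬ EqW u (L + 1) i j := by
    obtain ⟨j, hij, he⟩ := hr n i
    obtain ⟨M, hM⟩ := differ hC hij
    exact ⟨M, j, he, fun h => hM (h.mono (by omega))⟩
  obtain ⟨j, hj, hne⟩ := Nat.find_spec h
  have hmin := fun {m : ℕ} => Nat.find_min h (m := m)
  generalize Nat.find h = L at *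
  have hall : ∀ j, EqW u n i j → EqW u L i j := by
    intro j hj
    cases L with
    | zero => intro k hk; omega
    | succ L =>
      by_contra hc
      exact hmin (m := L) (by omega) ⟨j, hj, hc⟩
  have hnL : n ≤ L := by
    by_contra hc
    exact hne (hj.mono (by omega))
  have hrs : RSp u L i := ⟨j, hall j hj, fun h => hne ((hall j hj).succ h)⟩
  have hocc : ∀ j, OccursAt u (word u i n) j ↔ OccursAt u (word u i L) j := by
    intro j
    rw [occursAt_word, occursAt_word]
    exact ⟨hall j, fun h => h.mono hnL⟩
  have : returnWords u (word u i n) = returnWords u (word u i L) := by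
    simp only [returnWords, SuccOccurrences, hocc]
  rw [this]
  exact sturm_rs hab hA hC hrs

end helpers

/-- A binary infinite word is Sturmian iff every factor has
exactly two return words. -/
theorem stmt11 {A : Type*} [Fintype A] (u : ℕ → A)
    (hcard : Fintype.card A = 2)
    (hall : AllLettersOccur u) :
    (∀ n : ℕ, complexity u n = n + 1) ↔
      ∀ w : List A, IsFactor u w → Set.ncard (returnWords u w) = 2 := by
  obtain ⟨a, b, hab, hA⟩ : ∃ a b : A, a ≠ b ∧ ∀ x : A, x = a ∨ x = b := by
    rw [← Nat.card_eq_fintype_card, Nat.card_eq_two_iff] at hcard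
    obtain ⟨a, b, hab, h⟩ := hcard
    refine ⟨a, b, hab, fun x => ?_⟩
    have : x ∈ ({a, b} : Set A) := by rw [h]; trivial
    simpa using this
  constructor
  · exact fun h => sturm_two hab hA h
  · intro h
    have h' : TwoRet u := h
    exact complexity_of_one hab hA
      (fun n => RSset_ncard_one (h'.exists_rs n) (h'.unique_rs hA n))
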